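/- Let m ≥ 1 be an integer, let μ be the product measure on ℝ^m of m copies of the standard normal distribution N(0,1), let v ∈ ℝ^m, and let t ≥ 0. Then μ({y ∈ ℝ^m : ‖y − v‖₂ ≤ t}) = q_m(t², ‖v‖₂²), where ‖·‖₂ is the Euclidean norm. -/

import Mathlib

open MeasureTheory ProbabilityTheory

/-- The regularized lower incomplete gamma function
`γ̃(a, z) = (1/Γ(a)) ∫₀^z t^(a−1) e^(−t) dt`. -/
noncomputable def regGamma (a z : ℝ) : ℝ :=
  (∫ t in (0 : ℝ)..z, t ^ (a - 1) * Real.exp (-t)) / Real.Gamma a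

/-- The cumulative distribution function of the noncentral χ²-distribution with `m`
degrees of freedom and noncentrality parameter `u`, evaluated at `s`. -/
noncomputable def qchi (m s u : ℝ) : ℝ :=
  Real.exp (-u / 2) * ∑' l : ℕ, ((u / 2) ^ l / l.factorial) * regGamma (l + m / 2) (s / 2)

/-- The Euclidean norm on `ℝ^m`. -/
noncomputable def eucNorm {m : ℕ} (v : Fin m → ℝ) : ℝ :=
  Real.sqrt (∑ i, (v i) ^ 2)


open Complex

/-- The moment-generating function of the gamma distribution with rate one. -/
lemma mgf_id_gammaMeasure_one {a s : ℝ} (ha : 0 < a) (hs : s < 1) :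
    mgf id (gammaMeasure a 1) s = (1 - s) ^ (-a) := by
  have hs' : 0 < 1 - s := sub_pos.2 hs
  rw [mgf, gammaMeasure, integral_withDensity_eq_integral_toReal_smul
    (by unfold gammaPDF; fun_prop) (by simp [gammaPDF])]
  have h (x : ℝ) : (gammaPDF a 1 x).toReal • Real.exp (s * id x)
      = (1 - s) ^ (-a) * gammaPDFReal a (1 - s) x := by
    rw [gammaPDF, ENNReal.toReal_ofReal (gammaPDFReal_nonneg ha one_pos x)]
    unfold gammaPDFReal
    split_ifs with hx
    · rw [Real.rpow_neg hs'.le, smul_eq_mul, Real.one_rpow, id, mul_assoc, ← Real.exp_add]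
      have := (Real.rpow_pos_of_pos hs' a).ne'
      field_simp
      congr 2
      ring
    · simp
  have hint : ∫ x, gammaPDFReal a (1 - s) x = 1 := by
    rw [integral_eq_lintegral_of_nonneg_ae (ae_of_all _ (gammaPDFReal_nonneg ha hs'))
      (by fun_prop)]
    exact (congrArg ENNReal.toReal (lintegral_gammaPDF_eq_one ha hs')).trans (by simp)
  simp_rw [h, integral_const_mul, hint, mul_one]

/-- The characteristic function of the gamma distribution with rate one. -/
lemma charFun_gammaMeasure_one {a : ℝ} (ha : 0 < a) (t : ℝ) :
    charFun (gammaMeasure a 1) t = (1 - t * I) ^ (-a : ℂ) := by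
  have := isProbabilityMeasure_gammaMeasure ha one_pos
  have hsub : Set.Iio (1 : ℝ) ⊆ interior (integrableExpSet id (gammaMeasure a 1)) := by
    refine isOpen_Iio.subset_interior_iff.2 fun s hs ↦ ?_
    rw [integrableExpSet, Set.mem_ofPred_eq, ← mgf_pos_iff, mgf_id_gammaMeasure_one ha hs]
    exact Real.rpow_pos_of_pos (sub_pos.2 hs) _
  have hU : {z : ℂ | z.re < 1} ⊆
      {z | z.re ∈ interior (integrableExpSet id (gammaMeasure a 1))} := fun z hz ↦ hsub hz
  have hg : AnalyticOnNhd ℂ (fun z : ℂ ↦ (1 - z) ^ (-a : ℂ)) {z : ℂ | z.re < 1} := by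
    intro z hz
    refine AnalyticAt.cpow (by fun_prop) (by fun_prop) (Or.inl ?_)
    simpa using hz
  have key : Set.EqOn (complexMGF id (gammaMeasure a 1)) (fun z : ℂ ↦ (1 - z) ^ (-a : ℂ))
      {z : ℂ | z.re < 1} := by
    refine (analyticOnNhd_complexMGF.mono hU).eqOn_of_preconnected_of_frequently_eq hg
      ((convex_Iio (1 : ℝ)).linear_preimage reLm).isPreconnected (z₀ := ((0 : ℝ) : ℂ))
      (by simp) ?_
    have hlim : Filter.Tendsto ((↑) : ℝ → ℂ) (nhdsWithin 0 {0}ᶜ)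
        (nhdsWithin ((0 : ℝ) : ℂ) {((0 : ℝ) : ℂ)}ᶜ) :=
      continuous_ofReal.continuousWithinAt.tendsto_nhdsWithin fun x hx ↦ by simpa using hx
    refine hlim.frequently (Filter.Eventually.frequently ?_)
    filter_upwards [nhdsWithin_le_nhds (Iio_mem_nhds one_pos)] with s hs
    rw [complexMGF_ofReal, mgf_id_gammaMeasure_one ha hs, ofReal_cpow (sub_pos.2 hs).le]
    push_cast
    rfl
  rw [← complexMGF_id_mul_I, key (by simp)]

lemma inv_sqrt_mul_cpow_half {r : ℝ} (hr : 0 < r) {w : ℂ} (hw : 0 < w.re) :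
    ((√r)⁻¹ : ℝ) * (r * w⁻¹) ^ (1 / 2 : ℂ) = w ^ (-(1 / 2) : ℂ) := by
  have harg : w.arg ≠ Real.pi := fun h ↦ by
    have := (arg_eq_pi_iff.1 h).1
    linarith
  have hw0 : w ≠ 0 := by rintro rfl; simp at hw
  have hsqrt : ((√r)⁻¹ : ℝ) * cexp (Real.log r * (1 / 2)) = 1 := by
    rw [Real.sqrt_eq_rpow, Real.rpow_def_of_pos hr, ← Real.exp_neg, ofReal_exp, ← Complex.exp_add]
    simp
  rw [cpow_def_of_ne_zero (mul_ne_zero (by exact_mod_cast hr.ne') (inv_ne_zero hw0)),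
    log_ofReal_mul hr (inv_ne_zero hw0), log_inv _ harg, add_mul, Complex.exp_add, ← mul_assoc,
    hsqrt, one_mul, cpow_def_of_ne_zero hw0]
  ring_nf

/-- The characteristic function of half the square of a shifted standard Gaussian variable. -/
lemma charFun_map_half_sq_sub_gaussianReal (c t : ℝ) :
    charFun ((gaussianReal 0 1).map fun y ↦ (y - c) ^ 2 / 2) t
      = (1 - t * I) ^ (-(1 / 2) : ℂ) * cexp (c ^ 2 / 2 * ((1 - t * I)⁻¹ - 1)) := by
  have hw : 0 < (1 - t * I : ℂ).re := by simp
  have hw0 : (1 - t * I : ℂ) ≠ 0 := fun h ↦ by simp [h] at hw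
  have hb : (-((1 - t * I) / 2) : ℂ).re < 0 := by simp
  rw [charFun_apply_real, integral_map (by fun_prop) (by fun_prop),
    integral_gaussianReal_eq_integral_smul one_ne_zero]
  have h (y : ℝ) : gaussianPDFReal 0 1 y • cexp (t * ((y - c) ^ 2 / 2 : ℝ) * I)
      = ((√(2 * Real.pi))⁻¹ : ℝ) * cexp (-((1 - t * I) / 2) * y ^ 2 + (-(t * I * c)) * y
        + t * I * c ^ 2 / 2) := by
    rw [gaussianPDFReal, real_smul, ofReal_mul, mul_assoc, ofReal_exp, ← Complex.exp_add]
    simp only [NNReal.coe_one, mul_one]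
    congr 2
    push_cast
    ring
  simp_rw [h]
  rw [integral_const_mul, integral_cexp_quadratic hb, ← mul_assoc,
    ← inv_sqrt_mul_cpow_half Real.two_pi_pos hw]
  congr 3
  · push_cast
    field_simp
  · field_simp
    ring

lemma charFun_map_half_sum_sq_sub_pi_gaussianReal {ι : Type*} [Fintype ι] (v : ι → ℝ) (t : ℝ) :
    charFun ((Measure.pi fun _ : ι ↦ gaussianReal 0 1).map fun y ↦ ∑ i, (y i - v i) ^ 2 / 2) t
      = (1 - t * I) ^ (-(Fintype.card ι / 2) : ℂ)
        * cexp ((∑ i, v i ^ 2 : ℝ) / 2 * ((1 - t * I)⁻¹ - 1)) := by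
  have hind := iIndepFun_pi (μ := fun _ : ι ↦ gaussianReal 0 1)
    (X := fun i y ↦ (y - v i) ^ 2 / 2) (fun i ↦ by fun_prop)
  rw [hind.charFun_map_fun_sum_eq_prod (fun i ↦ Measurable.aemeasurable (by fun_prop)), Finset.prod_apply]
  have hmap (i : ι) : (Measure.pi fun _ : ι ↦ gaussianReal 0 1).map
      (fun y ↦ (y i - v i) ^ 2 / 2) = (gaussianReal 0 1).map fun y ↦ (y - v i) ^ 2 / 2 := by
    conv_rhs => rw [← (measurePreserving_eval (fun _ : ι ↦ gaussianReal 0 1) i).map_eq,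
      Measure.map_map (by fun_prop) (by fun_prop)]
    rfl
  simp_rw [hmap, charFun_map_half_sq_sub_gaussianReal, Finset.prod_mul_distrib,
    ← Complex.exp_sum, ← Finset.sum_mul, ← Finset.sum_div, Finset.prod_const, ← cpow_nat_mul]
  push_cast
  congr 2
  rw [Finset.card_univ]
  ring

/-- The Poisson mixture, with mean `r`, of the gamma distributions with shape `l + a` and rate
one. -/
noncomputable def poissonGammaMeasure (a r : ℝ) : Measure ℝ :=
  Measure.sum fun l : ℕ ↦
    ENNReal.ofReal (Real.exp (-r) * (r ^ l / l.factorial)) • gammaMeasure (l + a) 1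

lemma hasSum_exp_neg_mul_pow_div_factorial (r : ℝ) :
    HasSum (fun l : ℕ ↦ Real.exp (-r) * (r ^ l / l.factorial)) 1 := by
  convert! (NormedSpace.expSeries_div_hasSum_exp r).mul_left (Real.exp (-r)) using 1
  simp [← Real.exp_eq_exp_ℝ, ← Real.exp_add]

lemma isProbabilityMeasure_poissonGammaMeasure {a r : ℝ} (ha : 0 < a) (hr : 0 ≤ r) :
    IsProbabilityMeasure (poissonGammaMeasure a r) where
  measure_univ := by
    have h (l : ℕ) : gammaMeasure (l + a) 1 Set.univ = 1 :=
      (isProbabilityMeasure_gammaMeasure (by positivity) one_pos).measure_univ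
    simp only [poissonGammaMeasure, Measure.sum_apply _ MeasurableSet.univ, Measure.smul_apply, h,
      smul_eq_mul, mul_one]
    rw [← ENNReal.ofReal_tsum_of_nonneg (fun l ↦ by positivity)
      (hasSum_exp_neg_mul_pow_div_factorial r).summable,
      (hasSum_exp_neg_mul_pow_div_factorial r).tsum_eq, ENNReal.ofReal_one]

lemma charFun_poissonGammaMeasure {a r : ℝ} (ha : 0 < a) (hr : 0 ≤ r) (t : ℝ) :
    charFun (poissonGammaMeasure a r) t
      = (1 - t * I) ^ (-a : ℂ) * cexp (r * ((1 - t * I)⁻¹ - 1)) := by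
  have := isProbabilityMeasure_poissonGammaMeasure ha hr
  have hw0 : (1 - t * I : ℂ) ≠ 0 := fun h ↦ by simpa using congrArg re h
  have hint : Integrable (fun x : ℝ ↦ cexp (t * x * I)) (poissonGammaMeasure a r) := by
    refine Integrable.of_bound (by fun_prop) 1 (ae_of_all _ fun x ↦ ?_)
    rw [← ofReal_mul, norm_exp_ofReal_mul_I]
  have hterm (l : ℕ) : ∫ x : ℝ, cexp (t * x * I)
        ∂(ENNReal.ofReal (Real.exp (-r) * (r ^ l / l.factorial)) • gammaMeasure (l + a) 1)
      = (1 - t * I) ^ (-a : ℂ) * cexp (-r) * ((r * (1 - t * I)⁻¹) ^ l / l.factorial) := by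
    rw [integral_smul_measure, ← charFun_apply_real, charFun_gammaMeasure_one (by positivity),
      ENNReal.toReal_ofReal (by positivity), real_smul]
    push_cast
    rw [neg_add, cpow_add _ _ hw0, cpow_neg _ (l : ℂ), cpow_natCast, mul_pow, inv_pow]
    ring
  rw [charFun_apply_real]
  refine (hasSum_integral_measure hint).unique ?_
  simp_rw [hterm]
  convert! (NormedSpace.expSeries_div_hasSum_exp (r * (1 - t * I)⁻¹ : ℂ)).mul_left
    ((1 - t * I) ^ (-a : ℂ) * cexp (-r)) using 1
  rw [← Complex.exp_eq_exp_ℂ, mul_assoc, ← Complex.exp_add]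
  ring_nf

lemma map_half_sum_sq_sub_pi_gaussianReal {ι : Type*} [Fintype ι] [Nonempty ι] (v : ι → ℝ) :
    (Measure.pi fun _ : ι ↦ gaussianReal 0 1).map (fun y ↦ ∑ i, (y i - v i) ^ 2 / 2)
      = poissonGammaMeasure (Fintype.card ι / 2) ((∑ i, v i ^ 2) / 2) := by
  have ha : 0 < (Fintype.card ι / 2 : ℝ) := by
    have := Fintype.card_pos (α := ι)
    positivity
  have hr : 0 ≤ (∑ i, v i ^ 2) / 2 := by positivity
  have := isProbabilityMeasure_poissonGammaMeasure ha hr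
  have := Measure.isProbabilityMeasure_map (μ := Measure.pi fun _ : ι ↦ gaussianReal 0 1)
    (f := fun y ↦ ∑ i, (y i - v i) ^ 2 / 2) (Measurable.aemeasurable (by fun_prop))
  refine Measure.ext_of_charFun (funext fun t ↦ ?_)
  rw [charFun_map_half_sum_sq_sub_pi_gaussianReal, charFun_poissonGammaMeasure ha hr]
  push_cast
  rfl

lemma regGamma_nonneg {a z : ℝ} (ha : 0 < a) (hz : 0 ≤ z) : 0 ≤ regGamma a z := by
  refine div_nonneg (intervalIntegral.integral_nonneg hz fun t ht ↦ ?_) (Real.Gamma_pos_of_pos ha).le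
  have := ht.1
  positivity

lemma gammaMeasure_one_Iic {a z : ℝ} (ha : 0 < a) (hz : 0 ≤ z) :
    gammaMeasure a 1 (Set.Iic z) = ENNReal.ofReal (regGamma a z) := by
  have := isProbabilityMeasure_gammaMeasure ha one_pos
  rw [← ofReal_cdf, cdf_gammaMeasure_eq_integral ha one_pos, regGamma]
  congr 1
  have hpdf : gammaPDFReal a 1 =
      (Set.Ici 0).indicator fun x ↦ x ^ (a - 1) * Real.exp (-x) / Real.Gamma a := by
    ext x
    simp only [gammaPDFReal, Set.indicator, Set.mem_Ici, Real.one_rpow, one_mul]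
    congr 1
    ring
  rw [hpdf, setIntegral_indicator measurableSet_Ici, Set.inter_comm, Set.Ici_inter_Iic,
    integral_Icc_eq_integral_Ioc, integral_div, intervalIntegral.integral_of_le hz]

lemma regGamma_le_one {a z : ℝ} (ha : 0 < a) (hz : 0 ≤ z) : regGamma a z ≤ 1 := by
  have := isProbabilityMeasure_gammaMeasure ha one_pos
  rw [← ENNReal.ofReal_le_one, ← gammaMeasure_one_Iic ha hz]
  exact prob_le_one

lemma poissonGammaMeasure_Iic {m s u : ℝ} (hm : 0 < m) (hs : 0 ≤ s) (hu : 0 ≤ u) :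
    poissonGammaMeasure (m / 2) (u / 2) (Set.Iic (s / 2)) = ENNReal.ofReal (qchi m s u) := by
  have hnn (l : ℕ) : 0 ≤ regGamma (l + m / 2) (s / 2) :=
    regGamma_nonneg (by positivity) (by positivity)
  have hw (l : ℕ) : 0 ≤ Real.exp (-(u / 2)) * ((u / 2) ^ l / l.factorial) := by positivity
  simp only [poissonGammaMeasure, Measure.sum_apply _ measurableSet_Iic, Measure.smul_apply,
    smul_eq_mul]
  have hterm (l : ℕ) : ENNReal.ofReal (Real.exp (-(u / 2)) * ((u / 2) ^ l / l.factorial))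
        * gammaMeasure (l + m / 2) 1 (Set.Iic (s / 2))
      = ENNReal.ofReal (Real.exp (-(u / 2)) * ((u / 2) ^ l / l.factorial)
        * regGamma (l + m / 2) (s / 2)) := by
    rw [gammaMeasure_one_Iic (by positivity) (by positivity), ENNReal.ofReal_mul (hw l)]
  simp_rw [hterm]
  rw [← ENNReal.ofReal_tsum_of_nonneg (fun l ↦ mul_nonneg (hw l) (hnn l)), qchi, ← tsum_mul_left]
  · simp only [neg_div, mul_assoc]
  · exact (hasSum_exp_neg_mul_pow_div_factorial (u / 2)).summable.of_nonneg_of_le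
      (fun l ↦ mul_nonneg (hw l) (hnn l)) fun l ↦
        mul_le_of_le_one_right (hw l) (regGamma_le_one (by positivity) (by positivity))

/-- if `μ` is the product on `ℝ^m` (`m ≥ 1`) of `m` copies of the
standard normal distribution `N(0,1)`, `v ∈ ℝ^m` and `t ≥ 0`, then
`μ({y : ‖y − v‖₂ ≤ t}) = q_m(t², ‖v‖₂²)`. -/
theorem stmt15 (m : ℕ) (hm : 1 ≤ m) (v : Fin m → ℝ) (t : ℝ) (ht : 0 ≤ t) :
    Measure.pi (fun _ : Fin m => gaussianReal 0 1)
        {y : Fin m → ℝ | eucNorm (y - v) ≤ t}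
      = ENNReal.ofReal (qchi m (t ^ 2) (eucNorm v ^ 2)) := by
  have : Nonempty (Fin m) := ⟨⟨0, hm⟩⟩
  have hset : {y : Fin m → ℝ | eucNorm (y - v) ≤ t}
      = (fun y ↦ ∑ i, (y i - v i) ^ 2 / 2) ⁻¹' Set.Iic (t ^ 2 / 2) := by
    ext y
    simp only [Set.mem_ofPred_eq, Set.mem_preimage, Set.mem_Iic, eucNorm, Pi.sub_apply,
      ← Finset.sum_div, Real.sqrt_le_left ht]
    exact (div_le_div_iff_of_pos_right two_pos).symm
  rw [hset, ← Measure.map_apply (by fun_prop) measurableSet_Iic,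
    map_half_sum_sq_sub_pi_gaussianReal, Fintype.card_fin, eucNorm,
    Real.sq_sqrt (by positivity),
    poissonGammaMeasure_Iic (by positivity) (by positivity) (by positivity)]
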